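/- arXiv:2304.05477 — 5 statements merged into one kernel-verified Lean document; each statement's English description precedes it below -/
import Mathlib

section
/- Let C be a category with a terminal object ⊤ and binary products, and let (N, z, σ) be a parametrised natural number object in C. Then for every pair of morphisms g : A ⟶ B and h : (A ⨯ N) ⨯ B ⟶ B there exists a unique morphism f : A ⨯ N ⟶ B such that f ∘ prod.lift (𝟙 A) (z ∘ !_A) = g and f ∘ prod.map (𝟙 A) σ = h ∘ prod.lift (𝟙 (A ⨯ N)) f. (Intuitively, f is obtained by primitive recursion: f(a,0) = g(a) and f(a, σ n) = h(a, n, f(a,n)).) -/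
open CategoryTheory CategoryTheory.Limits

/-- **Primitive recursion from a parametrised natural number object.**
If `(N, z, σ)` is a PNO in a category `C` with terminal object and binary
products, then for all `g : A ⟶ B` and `h : (A ⨯ N) ⨯ B ⟶ B` there is a unique
`f : A ⨯ N ⟶ B` with `f ∘ ⟨𝟙 A, z ∘ !⟩ = g` and
`f ∘ (𝟙 A × σ) = h ∘ ⟨𝟙, f⟩`. -/
theorem pno_primitive_recursion {C : Type*} [Category C]
    [HasTerminal C] [HasBinaryProducts C]
    (N : C) (z : ⊤_ C ⟶ N) (σ : N ⟶ N)
    (hPNO : ∀ {A X : C} (f : A ⟶ X) (g : X ⟶ X),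
      ∃! r : A ⨯ N ⟶ X,
        prod.lift (𝟙 A) (terminal.from A ≫ z) ≫ r = f ∧
        prod.map (𝟙 A) σ ≫ r = r ≫ g)
    {A B : C} (g : A ⟶ B) (h : (A ⨯ N) ⨯ B ⟶ B) :
    ∃! f : A ⨯ N ⟶ B,
      prod.lift (𝟙 A) (terminal.from A ≫ z) ≫ f = g ∧
      prod.map (𝟙 A) σ ≫ f = prod.lift (𝟙 (A ⨯ N)) f ≫ h := by
  obtain ⟨r, ⟨hr_zero, hr_succ⟩, hr_unique⟩ :=
    hPNO (prod.lift (prod.lift (𝟙 A) (terminal.from A ≫ z)) g)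
      (prod.lift (prod.fst ≫ prod.map (𝟙 A) σ) h)
  have hr_fst : r ≫ prod.fst = 𝟙 (A ⨯ N) := by
    refine (hPNO (prod.lift (𝟙 A) (terminal.from A ≫ z)) (prod.map (𝟙 A) σ)).unique
      ⟨?_, ?_⟩ ⟨Category.comp_id _, by rw [Category.comp_id, Category.id_comp]⟩
    · rw [← Category.assoc, hr_zero, prod.lift_fst]
    · rw [← Category.assoc, hr_succ, Category.assoc, prod.lift_fst, Category.assoc]
  have lift_r_snd : prod.lift (𝟙 _) (r ≫ prod.snd) = r :=
    Limits.prod.hom_ext (by rw [prod.lift_fst, hr_fst]) (prod.lift_snd _ _)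
  refine ⟨r ≫ prod.snd, ⟨?_, ?_⟩, ?_⟩
  · rw [← Category.assoc, hr_zero, prod.lift_snd]
  · rw [lift_r_snd, ← Category.assoc, hr_succ, Category.assoc, prod.lift_snd]
  · rintro f ⟨hf_zero, hf_succ⟩
    rw [← hr_unique (prod.lift (𝟙 _) f) ⟨?_, ?_⟩, prod.lift_snd]
    · rw [prod.comp_lift, Category.comp_id, hf_zero]
    · rw [prod.comp_lift, prod.comp_lift, hf_succ, Category.comp_id, prod.lift_fst_assoc,
        Category.id_comp]
end

section
/- Let C be a category with finite limits and let (N, z, σ) be a parametrised natural number object in C. Let X be an object of C, let φ be a subobject of X ⨯ N and ψ a subobject of X. Suppose that (i) ψ ≤ (Subobject.pullback (prod.lift (𝟙 X) (z ∘ !_X))).obj φ, i.e. ψ is contained in the pullback of φ along ⟨𝟙_X, z ∘ !_X⟩ : X ⟶ X ⨯ N, and (ii) ((Subobject.pullback (prod.fst : X ⨯ N ⟶ X)).obj ψ) ⊓ φ ≤ (Subobject.pullback (prod.map (𝟙 X) σ)).obj φ in the subobject lattice of X ⨯ N. Then (Subobject.pullback (prod.fst : X ⨯ N ⟶ X)).obj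 ψ ≤ φ. (This is the soundness of the Σ₁-induction rule for a PNO.) -/
open CategoryTheory CategoryTheory.Limits

theorem CategoryTheory.Subobject.pullback_obj_factors_iff {C : Type*} [Category C] [HasPullbacks C]
    {W Y Z : C} (f : Y ⟶ Z) (P : Subobject Z) (h : W ⟶ Y) :
    ((Subobject.pullback f).obj P).Factors h ↔ P.Factors (h ≫ f) := by
  have sq := Subobject.isPullback f P
  constructor
  · intro hf
    rw [← Subobject.factorThru_arrow _ h hf, Category.assoc, ← sq.w, ← Category.assoc]
    exact Subobject.factors_comp_arrow _
  · intro hf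
    rw [← sq.lift_snd (P.factorThru _ hf) h (Subobject.factorThru_arrow _ _ hf)]
    exact Subobject.factors_comp_arrow _

/-- **Soundness of the Σ₁-induction rule for a PNO.**
Let `(N, z, σ)` be a PNO in a category `C` with finite limits, `φ` a subobject
of `X ⨯ N` and `ψ` a subobject of `X`.  If `ψ ≤ ⟨𝟙, z∘!⟩*(φ)` and
`π₁*(ψ) ⊓ φ ≤ (𝟙 × σ)*(φ)`, then `π₁*(ψ) ≤ φ`. -/
theorem pno_induction_rule {C : Type*} [Category C] [HasFiniteLimits C]
    (N : C) (z : ⊤_ C ⟶ N) (σ : N ⟶ N)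
    (hPNO : ∀ {A X : C} (f : A ⟶ X) (g : X ⟶ X),
      ∃! r : A ⨯ N ⟶ X,
        prod.lift (𝟙 A) (terminal.from A ≫ z) ≫ r = f ∧
        prod.map (𝟙 A) σ ≫ r = r ≫ g)
    (X : C) (φ : Subobject (X ⨯ N)) (ψ : Subobject X)
    (hbase : ψ ≤ (Subobject.pullback (prod.lift (𝟙 X) (terminal.from X ≫ z))).obj φ)
    (hstep : (Subobject.pullback (prod.fst : X ⨯ N ⟶ X)).obj ψ ⊓ φ ≤
      (Subobject.pullback (prod.map (𝟙 X) σ)).obj φ) :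
    (Subobject.pullback (prod.fst : X ⨯ N ⟶ X)).obj ψ ≤ φ := by
  let P := (Subobject.pullback (prod.fst : X ⨯ N ⟶ X)).obj ψ ⊓ φ
  have base : P.Factors (ψ.arrow ≫ prod.lift (𝟙 X) (terminal.from X ≫ z)) := by
    refine (Subobject.inf_factors _).2 ⟨?_, ?_⟩
    · rw [Subobject.pullback_obj_factors_iff, Category.assoc, prod.lift_fst, Category.comp_id]
      exact ψ.factors_self
    · rw [← Subobject.pullback_obj_factors_iff]
      exact Subobject.factors_of_le _ hbase ψ.factors_self
  have step : P.Factors (P.arrow ≫ prod.map (𝟙 X) σ) := by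
    refine (Subobject.inf_factors _).2 ⟨?_, ?_⟩
    · rw [Subobject.pullback_obj_factors_iff, Category.assoc, prod.map_fst, Category.comp_id,
        ← Subobject.pullback_obj_factors_iff]
      exact Subobject.factors_left_of_inf_factors P.factors_self
    · rw [← Subobject.pullback_obj_factors_iff]
      exact Subobject.factors_of_le _ hstep P.factors_self
  obtain ⟨r, ⟨hr_zero, hr_succ⟩, -⟩ := hPNO (P.factorThru _ base) (P.factorThru _ step)
  have hr : r ≫ P.arrow = prod.map ψ.arrow (𝟙 N) := by
    refine (hPNO (ψ.arrow ≫ prod.lift (𝟙 X) (terminal.from X ≫ z))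
      (prod.map (𝟙 X) σ)).unique ⟨?_, ?_⟩ ⟨?_, ?_⟩
    · rw [← Category.assoc, hr_zero, Subobject.factorThru_arrow]
    · rw [← Category.assoc, hr_succ, Category.assoc, Subobject.factorThru_arrow, Category.assoc]
    · ext <;> simp [← Category.assoc]
    · ext <;> simp
  have hφ : φ.Factors (prod.map ψ.arrow (𝟙 N)) :=
    hr ▸ Subobject.factors_right_of_inf_factors (Subobject.factors_comp_arrow (P := P) r)
  apply Subobject.le_of_factors
  have harrow : prod.lift (Subobject.pullbackπ prod.fst ψ)
      (((Subobject.pullback (prod.fst : X ⨯ N ⟶ X)).obj ψ).arrow ≫ prod.snd) ≫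
        prod.map ψ.arrow (𝟙 N) =
      ((Subobject.pullback (prod.fst : X ⨯ N ⟶ X)).obj ψ).arrow := by
    apply prod.hom_ext
    · rw [Category.assoc, prod.map_fst, prod.lift_fst_assoc,
        (Subobject.isPullback (prod.fst : X ⨯ N ⟶ X) ψ).w]
    · rw [Category.assoc, prod.map_snd, Category.comp_id, prod.lift_snd]
  rw [← harrow]
  exact Subobject.factors_of_factors_right _ hφ
end

section
/- Let C and D be categories with terminal objects and binary products, let (N, z_C, σ_C) be a parametrised natural number object in C and (M, z_D, σ_D) one in D. Let F : C ⥤ D be a functor that preserves finite products (in particular the terminal object and binary products), and let η : F.obj N ≅ M be an isomorphism satisfying η.hom ∘ F.map z_C = z_D ∘ τ and η.hom ∘ F.map σ_C = σ_D ∘ η.hom, where τ : F.obj ⊤_C ⟶ ⊤_D is the canonical (iso)morphism. Then for all morphisms f : A ⟶ X and g : X ⟶ X in C, F.map (rec_{f,g}) ∘ μ = rec_{F.map f, F.map g}, where rec_{f,g} : A ⨯ N ⟶ X and rec_{F.map f, F.map g} : F.obj A ⨯ M ⟶ F.obj X are the maps given by the PNO universal properties, and μ : F.obj A ⨯ M ⟶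 F.obj (A ⨯ N) is the composite of prod.map (𝟙 (F.obj A)) η.inv with the inverse of the canonical product-comparison isomorphism F.obj (A ⨯ N) ≅ F.obj A ⨯ F.obj N. -/
open CategoryTheory CategoryTheory.Limits

/-- **PR-coherent functors preserve primitive recursion.**
If `F` preserves finite products and carries the PNO `(N, z_C, σ_C)` of `C`
to the PNO `(M, z_D, σ_D)` of `D` (via an isomorphism `η` compatible with zero
and successor), then `F.map rec_{f,g} ∘ μ = rec_{F f, F g}`, where `μ` is the
composite of `𝟙 × η.inv` with the inverse of the product comparison. -/
theorem pr_coherent_functor_preserves_rec {C D : Type*} [Category C] [Category D]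
    [HasTerminal C] [HasBinaryProducts C] [HasTerminal D] [HasBinaryProducts D]
    (N : C) (zC : ⊤_ C ⟶ N) (σC : N ⟶ N)
    (M : D) (zD : ⊤_ D ⟶ M) (σD : M ⟶ M)
    (hPNOC : ∀ {A X : C} (f : A ⟶ X) (g : X ⟶ X),
      ∃! r : A ⨯ N ⟶ X,
        prod.lift (𝟙 A) (terminal.from A ≫ zC) ≫ r = f ∧
        prod.map (𝟙 A) σC ≫ r = r ≫ g)
    (hPNOD : ∀ {A X : D} (f : A ⟶ X) (g : X ⟶ X),
      ∃! r : A ⨯ M ⟶ X,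
        prod.lift (𝟙 A) (terminal.from A ≫ zD) ≫ r = f ∧
        prod.map (𝟙 A) σD ≫ r = r ≫ g)
    (F : C ⥤ D) [PreservesFiniteProducts F]
    (η : F.obj N ≅ M)
    (hz : F.map zC ≫ η.hom = terminal.from (F.obj (⊤_ C)) ≫ zD)
    (hσ : F.map σC ≫ η.hom = η.hom ≫ σD)
    {A X : C} (f : A ⟶ X) (g : X ⟶ X)
    (rC : A ⨯ N ⟶ X)
    (hrC : prod.lift (𝟙 A) (terminal.from A ≫ zC) ≫ rC = f ∧
      prod.map (𝟙 A) σC ≫ rC = rC ≫ g)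
    (rD : F.obj A ⨯ M ⟶ F.obj X)
    (hrD : prod.lift (𝟙 (F.obj A)) (terminal.from (F.obj A) ≫ zD) ≫ rD = F.map f ∧
      prod.map (𝟙 (F.obj A)) σD ≫ rD = rD ≫ F.map g) :
    prod.map (𝟙 (F.obj A)) η.inv ≫ inv (prodComparison F A N) ≫ F.map rC = rD := by
  have hz_inv : terminal.from (F.obj A) ≫ zD ≫ η.inv = F.map (terminal.from A) ≫ F.map zC := by
    rw [← cancel_mono η.hom]
    simp only [Category.assoc, Iso.inv_hom_id, Category.comp_id, hz]
    rw [← Category.assoc]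
    congr 1
    exact Subsingleton.elim _ _
  have hσ_inv : σD ≫ η.inv = η.inv ≫ F.map σC := by
    rw [Iso.comp_inv_eq, Category.assoc, hσ, Iso.inv_hom_id_assoc]
  have hzero : prod.lift (𝟙 (F.obj A)) (terminal.from (F.obj A) ≫ zD) ≫
      prod.map (𝟙 (F.obj A)) η.inv ≫ inv (prodComparison F A N) =
        F.map (prod.lift (𝟙 A) (terminal.from A ≫ zC)) := by
    rw [← Category.assoc, IsIso.comp_inv_eq]
    ext
    · rw [Category.assoc, Category.assoc, prodComparison_fst, ← F.map_comp, prod.map_fst,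
        prod.lift_fst, prod.lift_fst_assoc, Category.id_comp, F.map_id]
    · rw [Category.assoc, Category.assoc, prodComparison_snd, ← F.map_comp, prod.map_snd,
        prod.lift_snd, prod.lift_snd_assoc, Category.assoc, hz_inv, F.map_comp]
  have hsucc : prod.map (𝟙 (F.obj A)) σD ≫
      prod.map (𝟙 (F.obj A)) η.inv ≫ inv (prodComparison F A N) =
        prod.map (𝟙 (F.obj A)) η.inv ≫ inv (prodComparison F A N) ≫
          F.map (prod.map (𝟙 A) σC) := by
    rw [prodComparison_inv_natural, F.map_id, prod.map_map_assoc, prod.map_map_assoc, hσ_inv]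
  refine (hPNOD (F.map f) (F.map g)).unique ⟨?_, ?_⟩ hrD
  · rw [← hrC.1, F.map_comp, ← hzero]
    simp only [Category.assoc]
  · have h := congrArg (· ≫ F.map rC) hsucc
    simp only [Category.assoc] at h ⊢
    rw [h, ← F.map_comp, hrC.2, F.map_comp]
end

section
/- Let s, t, f̄, ḡ : ℕ → ℕ be primitive recursive functions and let f, g : ℕ → ℕ be arbitrary functions satisfying f (s a) = t (f̄ a) for all a and g (t b) = t (ḡ b) for all b. Define Rec : ℕ → ℕ → ℕ by Rec x 0 = f x and Rec x (n+1) = g (Rec x n). Then there exists a primitive recursive function r : ℕ → ℕ such that Rec (s a) n = t (r (Nat.pair a n)) for all a, n. (This shows that the set-theoretic primitive recursion of morphisms tracked by primitive recursive functions is itself tracked by a primitive recursive function; it is the key step in showing that ℕ with its identity enumeration is a parametrised natural number object in the category of primitive-recursively enumerated sets.) -/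
/-- **Primitive recursion of tracked morphisms is tracked.**
If `f, g : ℕ → ℕ` are tracked on indices by primitive recursive functions
`fb, gb` relative to the enumerations `s, t` (i.e. `f ∘ s = t ∘ fb` and
`g ∘ t = t ∘ gb`), then the function `Rec` defined by `Rec x 0 = f x` and
`Rec x (n+1) = g (Rec x n)` is tracked by a primitive recursive function `r`:
`Rec (s a) n = t (r (Nat.pair a n))` for all `a, n`. -/
theorem prim_rec_tracked
    (s t fb gb : ℕ → ℕ)
    (hs : Nat.Primrec s) (ht : Nat.Primrec t)
    (hfb : Nat.Primrec fb) (hgb : Nat.Primrec gb)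
    (f g : ℕ → ℕ)
    (hf : ∀ a, f (s a) = t (fb a))
    (hg : ∀ b, g (t b) = t (gb b))
    (Rec : ℕ → ℕ → ℕ)
    (hRec0 : ∀ x, Rec x 0 = f x)
    (hRecS : ∀ x n, Rec x (n + 1) = g (Rec x n)) :
    ∃ r : ℕ → ℕ, Nat.Primrec r ∧ ∀ a n, Rec (s a) n = t (r (Nat.pair a n)) := by
  refine ⟨_, hfb.prec (hgb.comp (Nat.Primrec.right.comp Nat.Primrec.right)), fun a n => ?_⟩
  induction n with
  | zero => simp [hRec0, hf]
  | succ n ih => simpa [hRecS, hg] using congrArg g ih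
end

section
/- There exists a function f : ℕ → ℕ that is bijective and primitive recursive, but whose inverse is not primitive recursive; precisely, there exists f : ℕ → ℕ with Function.Bijective f and Nat.Primrec f such that every g : ℕ → ℕ satisfying g (f n) = n for all n fails to be primitive recursive. -/
open Nat.Partrec in
/-- The running time of a program for a computable function that is not primitive recursive is
itself not primitive recursive, although its graph is. -/
theorem Computable.exists_primrecRel_graph_not_primrec {u : ℕ → ℕ} (hu : Computable u)
    (hu' : ¬ Primrec u) :
    ∃ t : ℕ → ℕ, PrimrecRel (fun n s => t n = s) ∧ ¬ Primrec t := by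
  classical
  obtain ⟨c, hc⟩ := Code.exists_code.1 (Partrec.nat_iff.1 hu)
  have heval (n : ℕ) : u n ∈ c.eval n := by rw [hc]; exact Part.mem_some _
  have hhalt (n : ℕ) : ∃ s, (Code.evaln s c n).isSome := by
    obtain ⟨s, hs⟩ := Code.evaln_complete.1 (heval n)
    exact ⟨s, Option.isSome_of_mem hs⟩
  have hevaln : Primrec₂ fun n s => Code.evaln s c n :=
    Code.primrec_evaln.comp ((Primrec.snd.pair (.const c)).pair Primrec.fst)
  have hhalts : PrimrecRel fun n s => (Code.evaln s c n).isSome :=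
    Primrec.primrecPred ((Primrec.option_isSome.comp hevaln).of_eq fun _ => by simp)
  refine ⟨fun n => Nat.find (hhalt n), ?_, fun ht => hu' ?_⟩
  · refine (hhalts.and (hhalts.comp Primrec.fst (Primrec.pred.comp Primrec.snd)).not).of_eq ?_
    rintro ⟨n, s⟩
    simp only [Nat.find_eq_iff]
    refine and_congr_right fun hs => ⟨fun h m hm hmt => h ?_, fun h => h _ ?_⟩
    · obtain ⟨x, hx⟩ := Option.isSome_iff_exists.1 hmt
      exact Option.isSome_of_mem (Code.evaln_mono (Nat.le_pred_of_lt hm) hx)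
    · rcases s with _ | s
      · simp [Code.evaln] at hs
      · simp
  · refine (Primrec.option_getD.comp (hevaln.comp .id ht) (.const 0)).of_eq fun n => ?_
    obtain ⟨x, hx⟩ := Option.isSome_iff_exists.1 (Nat.find_spec (hhalt n))
    simpa [hx] using Part.mem_unique (Code.evaln_sound hx) (heval n)

theorem Primrec.nat_count {p : ℕ → Prop} [DecidablePred p] (hp : PrimrecPred p) :
    Primrec (Nat.count p) := by
  have hstep : Primrec₂ fun n k : ℕ => k + if p n then 1 else 0 :=
    Primrec.nat_add.comp Primrec.snd
      (Primrec.ite (hp.comp Primrec.fst) (.const 1) (.const 0))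
  refine (Primrec.nat_rec₁ 0 hstep).of_eq fun n => ?_
  induction n with
  | zero => simp
  | succ n ih => simp [Nat.count_succ, ih]

/-- Maps the point `(n, t n)` of the graph of `t` to `2 * n`, and enumerates the (codes of) points
off the graph increasingly by the odd numbers. -/
def graphSplit (t : ℕ → ℕ) (x : ℕ) : ℕ :=
  if t x.unpair.1 = x.unpair.2 then 2 * x.unpair.1
  else 2 * Nat.count (fun y => ¬ t y.unpair.1 = y.unpair.2) x + 1

theorem graphSplit_pair (t : ℕ → ℕ) (n : ℕ) : graphSplit t (Nat.pair n (t n)) = 2 * n := by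
  simp [graphSplit]

theorem graphSplit_bijective (t : ℕ → ℕ) : Function.Bijective (graphSplit t) := by
  constructor
  · intro x y hxy
    unfold graphSplit at hxy
    split_ifs at hxy with hx hy hy
    · have h : x.unpair.1 = y.unpair.1 := by omega
      rw [← Nat.pair_unpair x, ← Nat.pair_unpair y, ← hx, ← hy, h]
    · omega
    · omega
    · exact Nat.count_injective (p := fun y => ¬ t y.unpair.1 = y.unpair.2) hx hy (by omega)
  · intro m
    obtain ⟨k, rfl | rfl⟩ := m.even_or_odd'
    · exact ⟨_, graphSplit_pair t k⟩
    · have hinf : {y : ℕ | ¬ t y.unpair.1 = y.unpair.2}.Infinite := by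
        refine Set.infinite_of_injective_forall_mem (f := fun n => Nat.pair n (t n + 1)) ?_ ?_
        · intro a b hab
          exact (Nat.pair_eq_pair.1 hab).1
        · intro n
          simp
      refine ⟨Nat.nth (fun y => ¬ t y.unpair.1 = y.unpair.2) k, ?_⟩
      rw [graphSplit, if_neg (Nat.nth_mem_of_infinite hinf k), Nat.count_nth_of_infinite hinf]

theorem graphSplit_primrec {t : ℕ → ℕ} (ht : PrimrecRel fun n s => t n = s) :
    Primrec (graphSplit t) := by
  have hfst : Primrec fun x : ℕ => x.unpair.1 := Primrec.fst.comp Primrec.unpair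
  have hgraph : PrimrecPred fun x : ℕ => t x.unpair.1 = x.unpair.2 :=
    ht.comp hfst (Primrec.snd.comp Primrec.unpair)
  exact Primrec.ite hgraph (Primrec.nat_mul.comp (.const 2) hfst)
    (Primrec.succ.comp (Primrec.nat_mul.comp (.const 2) (Primrec.nat_count hgraph.not)))

/-- **A primitive recursive bijection whose inverse is not primitive
recursive.**  There is a bijective primitive recursive `f : ℕ → ℕ` such that
no left inverse of `f` is primitive recursive. -/
theorem exists_primrec_bijection_inverse_not_primrec :
    ∃ f : ℕ → ℕ, Function.Bijective f ∧ Nat.Primrec f ∧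
      ∀ g : ℕ → ℕ, (∀ n, g (f n) = n) → ¬ Nat.Primrec g := by
  obtain ⟨t, hgraph, ht⟩ := Computable.exists_primrecRel_graph_not_primrec
    (computable₂_ack.comp Computable.id Computable.id) not_primrec_ack_self
  refine ⟨graphSplit t, graphSplit_bijective t, Primrec.nat_iff.1 (graphSplit_primrec hgraph),
    fun g hg hprim => ht ?_⟩
  refine (Primrec.snd.comp (Primrec.unpair.comp ((Primrec.nat_iff.2 hprim).comp
    (Primrec.nat_mul.comp (.const 2) .id)))).of_eq fun n => ?_
  simp [← graphSplit_pair t n, hg]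
end
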